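/- arXiv:2204.03921 — 11 statements merged into one kernel-verified Lean document; each statement's English description precedes it below -/
import Mathlib

section
/- Let V be a generalized mixed lattice structure and x, y ∈ V. If u ∈ Min[x∨y] then there exists w ∈ Max[y∧x] such that x + y = u + w. Conversely, for any w ∈ Max[y∧x] there exists u ∈ Min[x∨y] such that x + y = u + w. -/
/-- The set `[x ∨ y] = {w : x ⊑ w ∧ y ≤ w}` of common upper bounds
(`sle` is the specific order `⊑`, `le` the initial order `≤`). -/
def upperSet {V : Type*} (sle le : V → V → Prop) (x y : V) : Set V :=
  {w | sle x w ∧ le y w}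

/-- The set `[x ∧ y] = {w : w ⊑ x ∧ w ≤ y}` of common lower bounds. -/
def lowerSet {V : Type*} (sle le : V → V → Prop) (x y : V) : Set V :=
  {w | sle w x ∧ le w y}

/-- `Min[x ∨ y]`: the minimal elements of `[x ∨ y]` with respect to the initial order `le`. -/
def minUpper {V : Type*} (sle le : V → V → Prop) (x y : V) : Set V :=
  {u | u ∈ upperSet sle le x y ∧ ∀ w ∈ upperSet sle le x y, le w u → w = u}

/-- `Max[x ∧ y]`: the maximal elements of `[x ∧ y]` with respect to the initial order `le`. -/
def maxLower {V : Type*} (sle le : V → V → Prop) (x y : V) : Set V :=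
  {v | v ∈ lowerSet sle le x y ∧ ∀ w ∈ lowerSet sle le x y, le v w → w = v}

/-- A generalized mixed lattice structure on a real vector space `V`:
two partial orders `le` (initial) and `sle` (specific), both compatible with the
vector space structure, with `sle` finer than `le`, and such that the sets
`Min[x ∨ y]` and `Max[x ∧ y]` are nonempty for all `x, y`. -/
structure IsGMLS (V : Type*) [AddCommGroup V] [Module ℝ V]
    (le sle : V → V → Prop) : Prop where
  le_refl : ∀ x, le x x
  le_trans : ∀ x y z, le x y → le y z → le x z
  le_antisymm : ∀ x y, le x y → le y x → x = y
  sle_refl : ∀ x, sle x x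
  sle_trans : ∀ x y z, sle x y → sle y z → sle x z
  sle_antisymm : ∀ x y, sle x y → sle y x → x = y
  add_le_add : ∀ x y z, le x y → le (x + z) (y + z)
  add_sle_add : ∀ x y z, sle x y → sle (x + z) (y + z)
  smul_le_smul : ∀ t : ℝ, 0 < t → ∀ x y, le x y → le (t • x) (t • y)
  smul_sle_smul : ∀ t : ℝ, 0 < t → ∀ x y, sle x y → sle (t • x) (t • y)
  sle_le : ∀ x y, sle x y → le x y
  min_nonempty : ∀ x y, (minUpper sle le x y).Nonempty
  max_nonempty : ∀ x y, (maxLower sle le x y).Nonempty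

namespace IsGMLS

variable {V : Type*} [AddCommGroup V] [Module ℝ V] {le sle : V → V → Prop}

theorem sub_le_sub_left (h : IsGMLS V le sle) {a b : V} (hab : le a b) (c : V) :
    le (c - b) (c - a) := by
  have := h.add_le_add a b (c - a - b) hab
  rwa [show a + (c - a - b) = c - b by abel, show b + (c - a - b) = c - a by abel] at this

theorem sub_sle_sub_left (h : IsGMLS V le sle) {a b : V} (hab : sle a b) (c : V) :
    sle (c - b) (c - a) := by
  have := h.add_sle_add a b (c - a - b) hab
  rwa [show a + (c - a - b) = c - b by abel, show b + (c - a - b) = c - a by abel] at this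

theorem sub_mem_lowerSet (h : IsGMLS V le sle) {x y u : V} (hu : u ∈ upperSet sle le x y) :
    x + y - u ∈ lowerSet sle le y x := by
  have h₁ := h.sub_sle_sub_left hu.1 (x + y)
  have h₂ := h.sub_le_sub_left hu.2 (x + y)
  rw [add_sub_cancel_left] at h₁
  rw [add_sub_cancel_right] at h₂
  exact ⟨h₁, h₂⟩

theorem sub_mem_upperSet (h : IsGMLS V le sle) {x y w : V} (hw : w ∈ lowerSet sle le y x) :
    x + y - w ∈ upperSet sle le x y := by
  have h₁ := h.sub_sle_sub_left hw.1 (x + y)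
  have h₂ := h.sub_le_sub_left hw.2 (x + y)
  rw [add_sub_cancel_right] at h₁
  rw [add_sub_cancel_left] at h₂
  exact ⟨h₁, h₂⟩

theorem sub_mem_maxLower (h : IsGMLS V le sle) {x y u : V} (hu : u ∈ minUpper sle le x y) :
    x + y - u ∈ maxLower sle le y x := by
  refine ⟨h.sub_mem_lowerSet hu.1, fun w hw hle => ?_⟩
  have hle' := h.sub_le_sub_left hle (x + y)
  rw [sub_sub_cancel] at hle'
  rw [← hu.2 _ (h.sub_mem_upperSet hw) hle', sub_sub_cancel]

theorem sub_mem_minUpper (h : IsGMLS V le sle) {x y w : V} (hw : w ∈ maxLower sle le y x) :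
    x + y - w ∈ minUpper sle le x y := by
  refine ⟨h.sub_mem_upperSet hw.1, fun u hu hle => ?_⟩
  have hle' := h.sub_le_sub_left hle (x + y)
  rw [sub_sub_cancel] at hle'
  rw [← hw.2 _ (h.sub_mem_lowerSet hu) hle', sub_sub_cancel]

end IsGMLS

/-- if `u ∈ Min[x ∨ y]` then some `w ∈ Max[y ∧ x]` satisfies `x + y = u + w`,
and conversely. -/
theorem minUpper_add_maxLower {V : Type*} [AddCommGroup V] [Module ℝ V]
    (le sle : V → V → Prop) (h : IsGMLS V le sle) (x y : V) :
    (∀ u ∈ minUpper sle le x y, ∃ w ∈ maxLower sle le y x, x + y = u + w) ∧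
    (∀ w ∈ maxLower sle le y x, ∃ u ∈ minUpper sle le x y, x + y = u + w) := by
  exact ⟨fun u hu => ⟨x + y - u, h.sub_mem_maxLower hu, (add_sub_cancel u (x + y)).symm⟩,
    fun w hw => ⟨x + y - w, h.sub_mem_minUpper hw, (sub_add_cancel (x + y) w).symm⟩⟩
end

section
/- Let V be a generalized mixed lattice structure and x, y ∈ V. Then the following are equivalent: (i) x ≤ y; (ii) Max[x∧y] = {x}; (iii) Min[y∨x] = {y}. -/
/-- If `x ≤ y`, then `x` is the only maximal element of `[x ∧ y]`. -/
theorem IsGMLS.maxLower_eq_singleton {V : Type*} [AddCommGroup V] [Module ℝ V]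
    {le sle : V → V → Prop} (h : IsGMLS V le sle) {x y : V} (hxy : le x y) :
    maxLower sle le x y = {x} := by
  have hx : x ∈ lowerSet sle le x y := ⟨h.sle_refl x, hxy⟩
  ext v
  constructor
  · rintro ⟨hv, hmax⟩
    exact (hmax x hx (h.sle_le v x hv.1)).symm
  · rintro rfl
    exact ⟨hx, fun w hw hvw => h.le_antisymm w v (h.sle_le w v hw.1) hvw⟩

/-- If `x ≤ y`, then `y` is the only minimal element of `[y ∨ x]`. -/
theorem IsGMLS.minUpper_eq_singleton {V : Type*} [AddCommGroup V] [Module ℝ V]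
    {le sle : V → V → Prop} (h : IsGMLS V le sle) {x y : V} (hxy : le x y) :
    minUpper sle le y x = {y} := by
  have hy : y ∈ upperSet sle le y x := ⟨h.sle_refl y, hxy⟩
  ext u
  constructor
  · rintro ⟨hu, hmin⟩
    exact (hmin y hy (h.sle_le y u hu.1)).symm
  · rintro rfl
    exact ⟨hy, fun w hw hwu => h.le_antisymm w u hwu (h.sle_le u w hw.1)⟩

/-- `x ≤ y` iff `Max[x ∧ y] = {x}` iff `Min[y ∨ x] = {y}`. -/
theorem le_iff_maxLower_iff_minUpper {V : Type*} [AddCommGroup V] [Module ℝ V]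
    (le sle : V → V → Prop) (h : IsGMLS V le sle) (x y : V) :
    (le x y ↔ maxLower sle le x y = {x}) ∧
    (le x y ↔ minUpper sle le y x = {y}) := by
  refine ⟨⟨h.maxLower_eq_singleton, fun e => ?_⟩, ⟨h.minUpper_eq_singleton, fun e => ?_⟩⟩
  · have hx : x ∈ maxLower sle le x y := e ▸ Set.mem_singleton x
    exact hx.1.2
  · have hy : y ∈ minUpper sle le y x := e ▸ Set.mem_singleton y
    exact hy.1.2
end

section
/- Let V be a generalized mixed lattice structure and x, y ∈ V. Then the following are equivalent: (i) x ⊑ y; (ii) Max[y∧x] = {x}; (iii) Min[x∨y] = {y}. -/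
/-- If `x` itself is a common lower bound in `[y ∧ x]`, it is the only maximal one. -/
theorem maxLower_eq_singleton_of_sle {V : Type*} {le sle : V → V → Prop}
    (le_refl : ∀ x, le x x) (le_antisymm : ∀ x y, le x y → le y x → x = y) {x y : V}
    (hxy : sle x y) : maxLower sle le y x = {x} := by
  have hx : x ∈ lowerSet sle le y x := ⟨hxy, le_refl x⟩
  ext v
  constructor
  · rintro ⟨hv, hmax⟩
    exact (hmax x hx hv.2).symm
  · rintro rfl
    exact ⟨hx, fun w hw hvw => le_antisymm w v hw.2 hvw⟩

/-- If `y` itself is a common upper bound in `[x ∨ y]`, it is the only minimal one. -/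
theorem minUpper_eq_singleton_of_sle {V : Type*} {le sle : V → V → Prop}
    (le_refl : ∀ x, le x x) (le_antisymm : ∀ x y, le x y → le y x → x = y) {x y : V}
    (hxy : sle x y) : minUpper sle le x y = {y} := by
  have hy : y ∈ upperSet sle le x y := ⟨hxy, le_refl y⟩
  ext u
  constructor
  · rintro ⟨hu, hmin⟩
    exact (hmin y hy hu.2).symm
  · rintro rfl
    exact ⟨hy, fun w hw hwu => le_antisymm w u hwu hw.2⟩

/-- `x ⊑ y` iff `Max[y ∧ x] = {x}` iff `Min[x ∨ y] = {y}`. -/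
theorem sle_iff_maxLower_iff_minUpper {V : Type*} [AddCommGroup V] [Module ℝ V]
    (le sle : V → V → Prop) (h : IsGMLS V le sle) (x y : V) :
    (sle x y ↔ maxLower sle le y x = {x}) ∧
    (sle x y ↔ minUpper sle le x y = {y}) := by
  refine ⟨⟨maxLower_eq_singleton_of_sle h.le_refl h.le_antisymm, fun hmax => ?_⟩,
    ⟨minUpper_eq_singleton_of_sle h.le_refl h.le_antisymm, fun hmin => ?_⟩⟩
  · have hx : x ∈ maxLower sle le y x := hmax ▸ Set.mem_singleton x
    exact hx.1.1
  · have hy : y ∈ minUpper sle le x y := hmin ▸ Set.mem_singleton y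
    exact hy.1.1
end

section
/- Let V be a generalized mixed lattice structure, x, y ∈ V and a ∈ ℝ with a ≥ 0. Then Max[(a·x)∧(a·y)] = a·Max[x∧y] and Min[(a·x)∨(a·y)] = a·Min[x∨y] (where a·S denotes the image of the set S under scalar multiplication by a). -/
theorem smul_mem_minUpper {V : Type*} [AddCommGroup V] [Module ℝ V] {sle le : V → V → Prop}
    (hle : ∀ t : ℝ, 0 < t → ∀ x y, le x y → le (t • x) (t • y))
    (hsle : ∀ t : ℝ, 0 < t → ∀ x y, sle x y → sle (t • x) (t • y))
    {x y u : V} {a : ℝ} (ha : 0 < a) (hu : u ∈ minUpper sle le x y) :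
    a • u ∈ minUpper sle le (a • x) (a • y) := by
  obtain ⟨⟨hxu, hyu⟩, hmin⟩ := hu
  refine ⟨⟨hsle a ha _ _ hxu, hle a ha _ _ hyu⟩, fun w ⟨hxw, hyw⟩ hwu => ?_⟩
  have hx := hsle a⁻¹ (inv_pos.2 ha) _ _ hxw
  have hy := hle a⁻¹ (inv_pos.2 ha) _ _ hyw
  have hw := hle a⁻¹ (inv_pos.2 ha) _ _ hwu
  rw [inv_smul_smul₀ ha.ne'] at hx hy hw
  rw [← hmin _ ⟨hx, hy⟩ hw, smul_inv_smul₀ ha.ne']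

theorem minUpper_smul_of_pos {V : Type*} [AddCommGroup V] [Module ℝ V] {sle le : V → V → Prop}
    (hle : ∀ t : ℝ, 0 < t → ∀ x y, le x y → le (t • x) (t • y))
    (hsle : ∀ t : ℝ, 0 < t → ∀ x y, sle x y → sle (t • x) (t • y))
    (x y : V) {a : ℝ} (ha : 0 < a) :
    minUpper sle le (a • x) (a • y) = (fun w => a • w) '' minUpper sle le x y := by
  refine Set.Subset.antisymm (fun u hu => ⟨a⁻¹ • u, ?_, smul_inv_smul₀ ha.ne' u⟩) ?_
  · simpa only [inv_smul_smul₀ ha.ne'] using smul_mem_minUpper hle hsle (inv_pos.2 ha) hu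
  · rintro _ ⟨u, hu, rfl⟩
    exact smul_mem_minUpper hle hsle ha hu

theorem minUpper_self {V : Type*} {sle le : V → V → Prop} (hle : ∀ x, le x x)
    (hanti : ∀ x y, le x y → le y x → x = y) (hsle : ∀ x, sle x x) (x : V) :
    minUpper sle le x x = {x} := by
  refine Set.Subset.antisymm (fun u hu => (hu.2 x ⟨hsle x, hle x⟩ hu.1.2).symm) ?_
  rintro _ rfl
  exact ⟨⟨hsle _, hle _⟩, fun w hw hwx => hanti _ _ hwx hw.2⟩

theorem minUpper_smul_of_nonneg {V : Type*} [AddCommGroup V] [Module ℝ V]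
    {sle le : V → V → Prop} (hrefl : ∀ x, le x x) (hanti : ∀ x y, le x y → le y x → x = y)
    (hsrefl : ∀ x, sle x x)
    (hle : ∀ t : ℝ, 0 < t → ∀ x y, le x y → le (t • x) (t • y))
    (hsle : ∀ t : ℝ, 0 < t → ∀ x y, sle x y → sle (t • x) (t • y))
    {x y : V} (hne : (minUpper sle le x y).Nonempty) {a : ℝ} (ha : 0 ≤ a) :
    minUpper sle le (a • x) (a • y) = (fun w => a • w) '' minUpper sle le x y := by
  rcases ha.eq_or_lt with rfl | ha
  · simp only [zero_smul, minUpper_self hrefl hanti hsrefl, hne.image_const]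
  · exact minUpper_smul_of_pos hle hsle x y ha

theorem maxLower_eq_minUpper_flip {V : Type*} (sle le : V → V → Prop) (x y : V) :
    maxLower sle le x y = minUpper (flip sle) (flip le) x y :=
  rfl

/-- for `a ≥ 0`, `Max[(a•x) ∧ (a•y)] = a • Max[x ∧ y]` and
`Min[(a•x) ∨ (a•y)] = a • Min[x ∨ y]`. -/
theorem maxLower_minUpper_smul_nonneg {V : Type*} [AddCommGroup V] [Module ℝ V]
    (le sle : V → V → Prop) (h : IsGMLS V le sle) (x y : V) (a : ℝ) (ha : 0 ≤ a) :
    maxLower sle le (a • x) (a • y) = (fun w => a • w) '' maxLower sle le x y ∧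
    minUpper sle le (a • x) (a • y) = (fun w => a • w) '' minUpper sle le x y := by
  constructor
  · rw [maxLower_eq_minUpper_flip, maxLower_eq_minUpper_flip]
    exact minUpper_smul_of_nonneg (sle := flip sle) (le := flip le) h.le_refl
      (fun x y hyx hxy => h.le_antisymm x y hxy hyx) h.sle_refl
      (fun t ht x y => h.smul_le_smul t ht y x) (fun t ht x y => h.smul_sle_smul t ht y x)
      (h.max_nonempty x y) ha
  · exact minUpper_smul_of_nonneg h.le_refl h.le_antisymm h.sle_refl h.smul_le_smul
      h.smul_sle_smul (h.min_nonempty x y) ha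
end

section
/- Let V be a generalized mixed lattice structure, x, y ∈ V and a ∈ ℝ with a < 0. Then Max[(a·x)∧(a·y)] = a·Min[x∨y] and Min[(a·x)∨(a·y)] = a·Max[x∧y] (where a·S denotes the image of the set S under scalar multiplication by a). -/
/-- Multiplication by a negative scalar reverses a relation compatible with the
vector space structure. -/
theorem rel_smul_iff_of_neg {V : Type*} [AddCommGroup V] [Module ℝ V] {r : V → V → Prop}
    (hadd : ∀ x y z, r x y → r (x + z) (y + z))
    (hsmul : ∀ t : ℝ, 0 < t → ∀ x y, r x y → r (t • x) (t • y))
    {a : ℝ} (ha : a < 0) (x y : V) : r (a • x) (a • y) ↔ r y x := by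
  have reverse : ∀ b : ℝ, b < 0 → ∀ u v, r u v → r (b • v) (b • u) := by
    intro b hb u v huv
    have key := hadd _ _ (b • u + b • v) (hsmul (-b) (neg_pos.2 hb) u v huv)
    have hu : (-b) • u + (b • u + b • v) = b • v := by module
    have hv : (-b) • v + (b • u + b • v) = b • u := by module
    rwa [hu, hv] at key
  refine ⟨fun hxy => ?_, reverse a ha y x⟩
  simpa only [inv_smul_smul₀ ha.ne] using reverse a⁻¹ (inv_lt_zero.2 ha) _ _ hxy

/-- A scalar multiplication that reverses both relations carries `Min[x ∨ y]` onto
`Max[(a • x) ∧ (a • y)]`. -/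
theorem maxLower_smul_of_reversing {V : Type*} [AddCommGroup V] [Module ℝ V]
    {le sle : V → V → Prop} {a : ℝ} (ha : a ≠ 0)
    (hle : ∀ x y, le (a • x) (a • y) ↔ le y x)
    (hsle : ∀ x y, sle (a • x) (a • y) ↔ sle y x) (x y : V) :
    maxLower sle le (a • x) (a • y) = (fun w => a • w) '' minUpper sle le x y := by
  have surj : Function.Surjective (fun w : V => a • w) :=
    fun v => ⟨a⁻¹ • v, smul_inv_smul₀ ha v⟩
  have inj : Function.Injective (fun w : V => a • w) := smul_right_injective V ha
  ext v
  obtain ⟨u, rfl⟩ := surj v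
  rw [inj.mem_set_image]
  refine and_congr (and_congr (hsle u x) (hle u y)) (surj.forall.trans (forall_congr' fun w => ?_))
  exact imp_congr (and_congr (hsle w x) (hle w y)) (imp_congr (hle u w) inj.eq_iff)

/-- for `a < 0`, `Max[(a•x) ∧ (a•y)] = a • Min[x ∨ y]` and
`Min[(a•x) ∨ (a•y)] = a • Max[x ∧ y]`. -/
theorem maxLower_minUpper_smul_neg {V : Type*} [AddCommGroup V] [Module ℝ V]
    (le sle : V → V → Prop) (h : IsGMLS V le sle) (x y : V) (a : ℝ) (ha : a < 0) :
    maxLower sle le (a • x) (a • y) = (fun w => a • w) '' minUpper sle le x y ∧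
    minUpper sle le (a • x) (a • y) = (fun w => a • w) '' maxLower sle le x y := by
  have hle := rel_smul_iff_of_neg h.add_le_add h.smul_le_smul ha
  have hsle := rel_smul_iff_of_neg h.add_sle_add h.smul_sle_smul ha
  exact ⟨maxLower_smul_of_reversing ha.ne hle hsle x y,
    maxLower_smul_of_reversing (le := flip le) (sle := flip sle) ha.ne
      (fun u v => hle v u) (fun u v => hsle v u) x y⟩
end

section
/- Let V be a generalized mixed lattice structure and x ∈ V. For any u ∈ Min[x∨0] there exists an element w ∈ Min[0∨(−x)] such that x = u − w; for this pair one has V_p ∩ Max[w∧u] = {0} and u + w ∈ Min[u∨w]. Conversely, if x = u − w and 0 ∈ Max[w∧u], then u ∈ Min[x∨0] and w ∈ Min[0∨(−x)]. -/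
namespace IsGMLS

variable {V : Type*} [AddCommGroup V] [Module ℝ V] {le sle : V → V → Prop}

theorem add_le_add_iff (h : IsGMLS V le sle) (x y z : V) : le (x + z) (y + z) ↔ le x y :=
  ⟨fun H => by simpa using h.add_le_add _ _ (-z) H, h.add_le_add x y z⟩

theorem add_sle_add_iff (h : IsGMLS V le sle) (x y z : V) : sle (x + z) (y + z) ↔ sle x y :=
  ⟨fun H => by simpa using h.add_sle_add _ _ (-z) H, h.add_sle_add x y z⟩

theorem sub_le_sub_left_iff (h : IsGMLS V le sle) (a x y : V) : le (a - x) (a - y) ↔ le y x := by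
  rw [← h.add_le_add_iff _ _ (x + y - a)]
  congr! 1 <;> abel

theorem sub_sle_sub_left_iff (h : IsGMLS V le sle) (a x y : V) :
    sle (a - x) (a - y) ↔ sle y x := by
  rw [← h.add_sle_add_iff _ _ (x + y - a)]
  congr! 1 <;> abel

theorem add_mem_minUpper_iff (h : IsGMLS V le sle) (x y u a : V) :
    u + a ∈ minUpper sle le (x + a) (y + a) ↔ u ∈ minUpper sle le x y := by
  simp only [minUpper, upperSet, Set.mem_ofPred_eq, h.add_sle_add_iff, h.add_le_add_iff]
  rw [← (Equiv.addRight a).forall_congr_right]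
  simp [h.add_sle_add_iff, h.add_le_add_iff]

theorem sub_mem_maxLower_iff (h : IsGMLS V le sle) (x y u a : V) :
    a - u ∈ maxLower sle le (a - x) (a - y) ↔ u ∈ minUpper sle le x y := by
  simp only [minUpper, upperSet, maxLower, lowerSet, Set.mem_ofPred_eq,
    h.sub_sle_sub_left_iff, h.sub_le_sub_left_iff]
  rw [← (Equiv.subLeft a).forall_congr_right]
  simp [h.sub_sle_sub_left_iff, h.sub_le_sub_left_iff]

theorem zero_mem_maxLower_iff (h : IsGMLS V le sle) (x u : V) :
    (0 : V) ∈ maxLower sle le (u - x) u ↔ u ∈ minUpper sle le x 0 := by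
  simpa using h.sub_mem_maxLower_iff x 0 u u

theorem sub_mem_minUpper_zero_neg_iff (h : IsGMLS V le sle) (x u : V) :
    u - x ∈ minUpper sle le 0 (-x) ↔ u ∈ minUpper sle le x 0 := by
  simpa [sub_eq_add_neg] using h.add_mem_minUpper_iff x 0 u (-x)

theorem add_mem_minUpper_iff_zero_mem_maxLower (h : IsGMLS V le sle) (u w : V) :
    u + w ∈ minUpper sle le u w ↔ (0 : V) ∈ maxLower sle le w u := by
  simpa using (h.sub_mem_maxLower_iff u w (u + w) (u + w)).symm

theorem nonneg_inter_maxLower_eq_zero (h : IsGMLS V le sle) {u w : V}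
    (h0 : (0 : V) ∈ maxLower sle le w u) :
    {v : V | le 0 v} ∩ maxLower sle le w u = {0} := by
  ext v
  constructor
  · rintro ⟨hv, hm⟩
    exact h0.2 v hm.1 hv
  · rintro rfl
    exact ⟨h.le_refl 0, h0⟩

end IsGMLS

/-- for any upper part `u ∈ Min[x ∨ 0]` there is a specific lower part
`w ∈ Min[0 ∨ (−x)]` with `x = u − w`, `V_p ∩ Max[w ∧ u] = {0}` and `u + w ∈ Min[u ∨ w]`;
conversely, if `x = u − w` and `0 ∈ Max[w ∧ u]` then `u ∈ Min[x ∨ 0]` and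
`w ∈ Min[0 ∨ (−x)]`. -/
theorem upperPart_decomposition {V : Type*} [AddCommGroup V] [Module ℝ V]
    (le sle : V → V → Prop) (h : IsGMLS V le sle) (x : V) :
    (∀ u ∈ minUpper sle le x 0, ∃ w ∈ minUpper sle le 0 (-x),
      x = u - w ∧ {v : V | le 0 v} ∩ maxLower sle le w u = {0} ∧
      u + w ∈ minUpper sle le u w) ∧
    (∀ u w : V, x = u - w → (0 : V) ∈ maxLower sle le w u →
      u ∈ minUpper sle le x 0 ∧ w ∈ minUpper sle le 0 (-x)) := by
  constructor
  · intro u hu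
    have h0 := (h.zero_mem_maxLower_iff x u).2 hu
    exact ⟨u - x, (h.sub_mem_minUpper_zero_neg_iff x u).2 hu, by abel,
      h.nonneg_inter_maxLower_eq_zero h0, (h.add_mem_minUpper_iff_zero_mem_maxLower u _).2 h0⟩
  · intro u w hx h0
    obtain rfl : w = u - x := by rw [hx]; abel
    have hu := (h.zero_mem_maxLower_iff x u).1 h0
    exact ⟨hu, (h.sub_mem_minUpper_zero_neg_iff x u).2 hu⟩
end

section
/- Let V be a generalized mixed lattice structure. Then the cone V_p is generating: every x ∈ V can be written as x = u − v with u, v ∈ V_p, i.e., V = V_p − V_p. -/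
/-- in a generalized mixed lattice structure the cone `V_p` is generating:
every element is a difference of two elements of `V_p`. -/
theorem pos_cone_generating {V : Type*} [AddCommGroup V] [Module ℝ V]
    (le sle : V → V → Prop) (h : IsGMLS V le sle) (x : V) :
    ∃ u v : V, le 0 u ∧ le 0 v ∧ x = u - v := by
  obtain ⟨w, ⟨hxw, h0w⟩, -⟩ := h.min_nonempty x 0
  refine ⟨w, w - x, h0w, ?_, (sub_sub_cancel w x).symm⟩
  simpa [sub_eq_add_neg] using h.add_le_add x w (-x) (h.sle_le x w hxw)
end

section
/- For every x ∈ E, the metric projection P_K x is a minimal element, with respect to the order ≤ induced by K*, of the set [0∨x] = {w ∈ E : w ∈ K and w − x ∈ K*}; that is, P_K x ∈ [0∨x] and if w ∈ [0∨x] satisfies w ≤ P_K x (i.e., P_K x − w ∈ K*), then w = P_K x. -/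
open scoped RealInnerProductSpace

/-- The dual cone `K* = {y : ⟨x, y⟩ ≥ 0 for all x ∈ K}`. -/
def dualSet {E : Type*} [NormedAddCommGroup E] [InnerProductSpace ℝ E] (K : Set E) : Set E :=
  {y | ∀ x ∈ K, 0 ≤ ⟪x, y⟫}

/-- The set `[x ∨ y] = {w : w ⊒ x ∧ w ≥ y}`, where `⊑` is induced by the cone `K`
and `≤` by its dual cone. -/
def upperSetK {E : Type*} [NormedAddCommGroup E] [InnerProductSpace ℝ E]
    (K : Set E) (x y : E) : Set E :=
  {w | w - x ∈ K ∧ w - y ∈ dualSet K}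

/-- The set `[x ∧ y] = {w : w ⊑ x ∧ w ≤ y}`. -/
def lowerSetK {E : Type*} [NormedAddCommGroup E] [InnerProductSpace ℝ E]
    (K : Set E) (x y : E) : Set E :=
  {w | x - w ∈ K ∧ y - w ∈ dualSet K}

/-- `Min[x ∨ y]`: minimal elements of `[x ∨ y]` with respect to the order `≤`
induced by the dual cone `K*`. -/
def minUpperK {E : Type*} [NormedAddCommGroup E] [InnerProductSpace ℝ E]
    (K : Set E) (x y : E) : Set E :=
  {u | u ∈ upperSetK K x y ∧ ∀ w ∈ upperSetK K x y, u - w ∈ dualSet K → w = u}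

/-- `Max[x ∧ y]`: maximal elements of `[x ∧ y]` with respect to the order `≤`
induced by the dual cone `K*`. -/
def maxLowerK {E : Type*} [NormedAddCommGroup E] [InnerProductSpace ℝ E]
    (K : Set E) (x y : E) : Set E :=
  {v | v ∈ lowerSetK K x y ∧ ∀ w ∈ lowerSetK K x y, w - v ∈ dualSet K → w = v}

/-- the metric projection `P_K x` is a minimal element, with respect to the
order induced by `K*`, of the set `[0 ∨ x] = {w : w ∈ K ∧ w − x ∈ K*}`. -/
theorem proj_mem_minUpper {E : Type*} [NormedAddCommGroup E] [InnerProductSpace ℝ E]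
    [FiniteDimensional ℝ E] (K : Set E)
    (hclosed : IsClosed K)
    (hsmul : ∀ t : ℝ, 0 ≤ t → ∀ x ∈ K, t • x ∈ K)
    (hadd : ∀ x ∈ K, ∀ y ∈ K, x + y ∈ K)
    (hpointed : ∀ x : E, x ∈ K → -x ∈ K → x = 0)
    (hKsub : K ⊆ dualSet K)
    (P : E → E)
    (hPmem : ∀ x : E, P x ∈ K)
    (hPchar : ∀ x : E, ∀ y ∈ K, ⟪P x - x, P x - y⟫ ≤ 0)
    (x : E) :
    (P x ∈ K ∧ P x - x ∈ dualSet K) ∧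
    ∀ w : E, w ∈ K → w - x ∈ dualSet K → P x - w ∈ dualSet K → w = P x := by
  have hzero : (0 : E) ∈ K := by simpa using hsmul 0 le_rfl (P x) (hPmem x)
  have hperp : ⟪P x - x, P x⟫ ≤ 0 := by simpa using hPchar x 0 hzero
  refine ⟨⟨hPmem x, fun k hk => ?_⟩, fun w hw hwx hPw => ?_⟩
  · have h := hPchar x (P x + k) (hadd _ (hPmem x) _ hk)
    rw [sub_add_cancel_left, inner_neg_right, real_inner_comm] at h
    linarith
  · have h₁ : 0 ≤ ⟪P x, w - x⟫ := hwx _ (hPmem x)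
    have h₂ : 0 ≤ ⟪w, P x - w⟫ := hPw _ hw
    have h₃ : ⟪P x - w, P x - w⟫ ≤ 0 := by
      rw [real_inner_comm] at hperp
      simp only [inner_sub_left, inner_sub_right] at hperp h₁ h₂ ⊢
      linarith
    exact (sub_eq_zero.mp (real_inner_self_nonpos.mp h₃)).symm
end

section
/- For all x, y ∈ E, the element x + P_K(y − x) (which equals the projection of y onto the translated cone x + K) is a minimal element, with respect to the order ≤ induced by K*, of the set [x∨y] = {w ∈ E : w − x ∈ K and w − y ∈ K*}. In particular, the sets Min[x∨y] and Max[x∧y] are nonempty for all x, y ∈ E, so (E, ≤, ⊑) is a generalized mixed lattice structure. -/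
open scoped RealInnerProductSpace

section ConeProjection

variable {E : Type*} [NormedAddCommGroup E] [InnerProductSpace ℝ E] {K : Set E} {p z : E}

/-- If `p` satisfies the variational characterization of the projection of `z` onto a cone `K`,
then `p - z` lies in the dual cone. -/
theorem sub_mem_dualSet_of_proj (hadd : ∀ x ∈ K, ∀ y ∈ K, x + y ∈ K) (hp : p ∈ K)
    (hchar : ∀ y ∈ K, ⟪p - z, p - y⟫ ≤ 0) : p - z ∈ dualSet K := by
  intro k hk
  have h := hchar (p + k) (hadd p hp k hk)
  rw [sub_add_cancel_left, inner_neg_right, real_inner_comm] at h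
  linarith

/-- If `p` satisfies the variational characterization of the projection of `z` onto a cone `K`,
then `p` is minimal among the points of `K ∩ (z + K*)` for the order induced by `K*`. -/
theorem eq_proj_of_sub_mem_dualSet (hzero : (0 : E) ∈ K) (hp : p ∈ K)
    (hchar : ∀ y ∈ K, ⟪p - z, p - y⟫ ≤ 0) {v : E} (hv : v ∈ K)
    (hvz : v - z ∈ dualSet K) (hpv : p - v ∈ dualSet K) : v = p := by
  have h0 := hchar 0 hzero
  have h1 := hvz p hp
  have h2 := hpv v hv
  have h3 : ⟪p - v, p - v⟫ ≤ 0 := by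
    simp only [inner_sub_left, inner_sub_right, sub_zero] at h0 h1 h2 ⊢
    linarith [real_inner_comm p v, real_inner_comm p z]
  exact (sub_eq_zero.mp (real_inner_self_nonpos.mp h3)).symm

end ConeProjection

/-- for all `x, y`, the element `x + P_K(y − x)` is a minimal element of
`[x ∨ y]` with respect to the order induced by `K*`; in particular all the sets
`Min[x ∨ y]` and `Max[x ∧ y]` are nonempty, so `(E, ≤, ⊑)` is a generalized mixed
lattice structure. -/
theorem translated_proj_minimal_and_gmls {E : Type*} [NormedAddCommGroup E]
    [InnerProductSpace ℝ E] [FiniteDimensional ℝ E] (K : Set E)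
    (hclosed : IsClosed K)
    (hsmul : ∀ t : ℝ, 0 ≤ t → ∀ x ∈ K, t • x ∈ K)
    (hadd : ∀ x ∈ K, ∀ y ∈ K, x + y ∈ K)
    (hpointed : ∀ x : E, x ∈ K → -x ∈ K → x = 0)
    (hKsub : K ⊆ dualSet K)
    (P : E → E)
    (hPmem : ∀ x : E, P x ∈ K)
    (hPchar : ∀ x : E, ∀ y ∈ K, ⟪P x - x, P x - y⟫ ≤ 0) :
    (∀ x y : E, x + P (y - x) ∈ minUpperK K x y) ∧
    (∀ x y : E, (minUpperK K x y).Nonempty ∧ (maxLowerK K x y).Nonempty) := by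
  have hdual : ∀ z, P z - z ∈ dualSet K := fun z =>
    sub_mem_dualSet_of_proj hadd (hPmem z) (hPchar z)
  have hzero : (0 : E) ∈ K := by simpa using hsmul 0 le_rfl (P 0) (hPmem 0)
  have hmin : ∀ x y : E, x + P (y - x) ∈ minUpperK K x y := by
    refine fun x y => ⟨⟨by simpa using hPmem (y - x), ?_⟩, fun w hw hle => ?_⟩
    · convert hdual (y - x) using 1
      abel
    · rw [← eq_proj_of_sub_mem_dualSet hzero (hPmem (y - x)) (hPchar (y - x)) hw.1
        (by simpa using hw.2) (by convert hle using 1; abel)]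
      abel
  refine ⟨hmin, fun x y => ⟨⟨_, hmin x y⟩, x - P (x - y), ⟨?_, ?_⟩, fun w hw hle => ?_⟩⟩
  · simpa using hPmem (x - y)
  · convert hdual (x - y) using 1
    abel
  · rw [← eq_proj_of_sub_mem_dualSet hzero (hPmem (x - y)) (hPchar (x - y)) hw.1
      (by convert hw.2 using 1; abel) (by convert hle using 1; abel)]
    abel
end

section
/- If x ∈ K and y ∈ K* satisfy ⟨x, y⟩ = 0, then 0 is a maximal element, with respect to the order ≤ induced by K*, of the set [x∧y] = {w ∈ E : x − w ∈ K and y − w ∈ K*}; that is, 0 ∈ [x∧y] and if w ∈ [x∧y] satisfies w ∈ K* then w = 0. -/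
open scoped RealInnerProductSpace

/-- if `x ∈ K`, `y ∈ K*` and `⟨x, y⟩ = 0`, then `0` is a maximal element of
`[x ∧ y]` with respect to the order induced by `K*`. -/
theorem orthogonal_zero_maximal {E : Type*} [NormedAddCommGroup E] [InnerProductSpace ℝ E]
    [FiniteDimensional ℝ E] (K : Set E)
    (hclosed : IsClosed K)
    (hsmul : ∀ t : ℝ, 0 ≤ t → ∀ x ∈ K, t • x ∈ K)
    (hadd : ∀ x ∈ K, ∀ y ∈ K, x + y ∈ K)
    (hpointed : ∀ x : E, x ∈ K → -x ∈ K → x = 0)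
    (hKsub : K ⊆ dualSet K)
    (x y : E) (hx : x ∈ K) (hy : y ∈ dualSet K) (hxy : ⟪x, y⟫ = 0) :
    (x - (0 : E) ∈ K ∧ y - (0 : E) ∈ dualSet K) ∧
    ∀ w : E, x - w ∈ K → y - w ∈ dualSet K → w ∈ dualSet K → w = 0 := by
  refine ⟨⟨by simpa using hx, by simpa using hy⟩, fun w hxw hyw hw => ?_⟩
  have hx_inner : 0 ≤ ⟪x, y - w⟫ := hyw x hx
  have hww : 0 ≤ ⟪x - w, w⟫ := hw (x - w) hxw
  rw [inner_sub_right, hxy] at hx_inner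
  rw [inner_sub_left] at hww
  exact inner_self_eq_zero.mp (le_antisymm (by linarith) real_inner_self_nonneg)
end

section
/- Every x ∈ E can be written as x = u − v, where u = P_K x ∈ K, v = P_{K*}(−x) ∈ K*, and 0 is a maximal element (with respect to the order ≤ induced by K*) of the set [u∧v] = {w ∈ E : u − w ∈ K and v − w ∈ K*}; moreover P_K(u − v) = u, and P_K x = 0 holds if and only if −x ∈ K*. -/
open scoped RealInnerProductSpace

/-- order-theoretic Moreau decomposition: every `x` satisfies
`x = P_K x − P_{K*}(−x)` with `P_K x ∈ K`, `P_{K*}(−x) ∈ K*`, `0` is a maximal element of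
`[P_K x ∧ P_{K*}(−x)]`, `P_K (P_K x − P_{K*}(−x)) = P_K x`, and `P_K x = 0 ↔ −x ∈ K*`. -/
theorem moreau_mixed_lattice {E : Type*} [NormedAddCommGroup E] [InnerProductSpace ℝ E]
    [FiniteDimensional ℝ E] (K : Set E)
    (hclosed : IsClosed K)
    (hsmul : ∀ t : ℝ, 0 ≤ t → ∀ x ∈ K, t • x ∈ K)
    (hadd : ∀ x ∈ K, ∀ y ∈ K, x + y ∈ K)
    (hpointed : ∀ x : E, x ∈ K → -x ∈ K → x = 0)
    (hKsub : K ⊆ dualSet K)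
    (P : E → E)
    (hPmem : ∀ x : E, P x ∈ K)
    (hPchar : ∀ x : E, ∀ y ∈ K, ⟪P x - x, P x - y⟫ ≤ 0)
    (P' : E → E)
    (hP'mem : ∀ z : E, P' z ∈ dualSet K)
    (hP'char : ∀ z : E, ∀ y ∈ dualSet K, ⟪P' z - z, P' z - y⟫ ≤ 0)
    (x : E) :
    x = P x - P' (-x) ∧ P x ∈ K ∧ P' (-x) ∈ dualSet K ∧
    (0 : E) ∈ maxLowerK K (P x) (P' (-x)) ∧
    P (P x - P' (-x)) = P x ∧
    (P x = 0 ↔ -x ∈ dualSet K) := by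
  have hu := hPmem x
  have h_orth : ⟪P x, P x - x⟫ = 0 := by
    have h₀ := hPchar x _ (hsmul 0 le_rfl _ hu)
    have h₂ := hPchar x _ (hadd _ hu _ hu)
    rw [zero_smul, sub_zero, real_inner_comm] at h₀
    rw [sub_add_cancel_left, inner_neg_right, real_inner_comm] at h₂
    linarith
  have h_dual : P x - x ∈ dualSet K := fun k hk => by
    have h := hPchar x _ (hadd _ hu k hk)
    rw [sub_add_cancel_left, inner_neg_right, real_inner_comm] at h
    linarith
  have h_proj : P' (-x) = P x - x := by
    have h₁ := hP'char (-x) _ h_dual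
    have h₂ := hP'mem (-x) _ hu
    have h : P' (-x) - -x = (P' (-x) - (P x - x)) + P x := by abel
    rw [h, inner_add_left, inner_sub_right (P x), h_orth] at h₁
    exact sub_eq_zero.mp (real_inner_self_nonpos.mp (by linarith))
  rw [h_proj, sub_sub_cancel]
  refine ⟨rfl, hu, h_dual, ⟨⟨by simpa using hu, by simpa using h_dual⟩, ?_⟩, rfl, ?_, ?_⟩
  · rintro w ⟨hw, hw'⟩ hw_dual
    rw [sub_zero] at hw_dual
    have h₁ := hw' _ hu
    have h₂ := hw_dual _ hw
    rw [inner_sub_right, h_orth] at h₁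
    rw [inner_sub_left] at h₂
    exact real_inner_self_nonpos.mp (by linarith)
  · intro h
    simpa [h] using h_dual
  · intro h
    have h₁ := h _ hu
    rw [sub_eq_add_neg, inner_add_right] at h_orth
    exact real_inner_self_nonpos.mp (by linarith)
end
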